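/- arXiv:2104.11825 — 2 statements merged into one kernel-verified Lean document; each statement's English description precedes it below -/
import Mathlib

section
/- Let λ ∈ (−1,0), α ∈ ℝ, β = λ + α > 1, and let f be the map on L = ℝ × [−1,1] given by f(x,s) = (λx + αs, Ψ(s + (λx + αs) − x)), where Ψ(τ) = τ if |τ| ≤ 1 and Ψ(τ) = 0 otherwise. Then there exists an f-invariant Borel probability measure μ on L that is non-atomic (μ({p}) = 0 for every point p) and whose topological support is disjoint from the fixed-point segment EF = {(x,s) : x = αs/(1−λ), −1 ≤ s ≤ 1}. -/
open Set MeasureTheory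

/-- The cut-off function `Ψ` for the interval `[-1,1]`. -/
noncomputable def Psi : ℝ → ℝ := fun τ => if |τ| ≤ 1 then τ else 0

/-- The risk management map `f(x,s) = (λx + αs, Ψ(s + (λx + αs) - x))`. -/
noncomputable def riskMap (lam a : ℝ) : ℝ × ℝ → ℝ × ℝ :=
  fun p => (lam * p.1 + a * p.2, Psi (p.2 + (lam * p.1 + a * p.2) - p.1))


/-- visits to a set, well separated in time, are rare -/
lemma card_sep (S : Finset ℕ) (n K : ℕ) (hK : 0 < K) (hS : ∀ i ∈ S, i < n)
    (hsep : ∀ i ∈ S, ∀ j ∈ S, i < j → K ≤ j - i) : S.card ≤ n / K + 1 := by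
  have h := Finset.card_le_card_of_injOn (s := S) (t := Finset.range (n / K + 1)) (fun i => i / K)
    (by
      intro i hi
      have := Nat.div_le_div_right (c := K) (hS i hi).le
      simp; omega)
    (by
      intro i hi j hj hij
      have key : ∀ i ∈ S, ∀ j ∈ S, i / K = j / K → i < j → False := by
        intro i hi j hj hij hlt
        have h1 := hsep i hi j hj hlt
        have : i / K + 1 ≤ j / K := by
          rw [← Nat.add_div_right i hK]
          exact Nat.div_le_div_right (by omega)
        omega
      rcases lt_trichotomy i j with h | h | h
      · exact (key i hi j hj hij h).elim
      · exact h
      · exact (key j hj i hi hij.symm h).elim)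
  simpa using h

lemma eq_of_closed_le (μ ν : Measure (ℝ × ℝ)) [IsProbabilityMeasure μ] [IsProbabilityMeasure ν]
    (h : ∀ F, IsClosed F → ν F ≤ μ F) : ν = μ := by
  have h1 : ∀ A, MeasurableSet A → ν A ≤ μ A := by
    intro A hA
    rw [hA.measure_eq_iSup_isClosed_of_ne_top (measure_ne_top ν A)]
    refine iSup_le fun F => iSup_le fun hF => iSup_le fun hFc => ?_
    exact (h F hFc).trans (measure_mono hF)
  ext A hA
  refine le_antisymm (h1 A hA) ?_
  have h2 := h1 Aᶜ hA.compl
  rw [prob_compl_eq_one_sub hA, prob_compl_eq_one_sub hA] at h2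
  exact (ENNReal.sub_le_sub_iff_left prob_le_one ENNReal.one_ne_top).1 h2

/-- empirical measure of an orbit -/
noncomputable def emp (x : ℕ → ℝ × ℝ) (n : ℕ) : Measure (ℝ × ℝ) :=
  ((n + 1 : ℕ) : ENNReal)⁻¹ • ∑ i ∈ Finset.range (n + 1), Measure.dirac (x i)

lemma emp_apply (x : ℕ → ℝ × ℝ) (n : ℕ) {S : Set (ℝ × ℝ)} (hS : MeasurableSet S) :
    emp x n S = ((n + 1 : ℕ) : ENNReal)⁻¹ *
      ∑ i ∈ Finset.range (n + 1), S.indicator (1 : ℝ × ℝ → ENNReal) (x i) := by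
  simp [emp, Measure.dirac_apply' _ hS]

instance (x : ℕ → ℝ × ℝ) (n : ℕ) : IsProbabilityMeasure (emp x n) := by
  constructor
  rw [emp_apply _ _ MeasurableSet.univ]
  simp only [indicator_univ, Pi.one_apply, Finset.sum_const, Finset.card_range, nsmul_eq_mul, mul_one]
  exact ENNReal.inv_mul_cancel (by simp) (by simp)

open Filter Topology in
theorem kb (f : ℝ × ℝ → ℝ × ℝ) (hf : Measurable f) (K D : Set (ℝ × ℝ)) (hK : IsCompact K)
    (hD : D.Countable) (hcont : ∀ p ∈ K, p ∉ D → ContinuousAt f p)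
    (p0 : ℝ × ℝ) (horb : ∀ n, f^[n] p0 ∈ K)
    (hret : ∀ k, 0 < k → ∃ ε > 0, ∀ i, ε ≤ dist (f^[i] p0) (f^[i + k] p0)) :
    ∃ μ : Measure (ℝ × ℝ), IsProbabilityMeasure μ ∧ μ Kᶜ = 0 ∧
      (∀ A : Set (ℝ × ℝ), MeasurableSet A → μ (f ⁻¹' A) = μ A) ∧ (∀ p : ℝ × ℝ, μ {p} = 0) := by
  set x : ℕ → ℝ × ℝ := fun n => f^[n] p0 with hx
  let ν : ℕ → ProbabilityMeasure (ℝ × ℝ) := fun n => ⟨emp x n, inferInstance⟩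
  have hempK : ∀ n, emp x n Kᶜ = 0 := by
    intro n
    rw [emp_apply _ _ hK.measurableSet.compl]
    have : ∀ i ∈ Finset.range (n + 1), Kᶜ.indicator (1 : ℝ × ℝ → ENNReal) (x i) = 0 := by
      intro i _
      simp [hx, horb i]
    rw [Finset.sum_eq_zero this, mul_zero]
  have hcomp := isCompact_setOfPred_probabilityMeasure_mass_eq_compl_isCompact_le
    (E := ℝ × ℝ) (u := fun _ => 0) (K := fun _ => K) tendsto_const_nhds (fun _ => hK)
    (Or.inr monotone_const)
  have hU := hcomp.ultrafilter_le_nhds' (Ultrafilter.map ν (hyperfilter ℕ)) (by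
    rw [Ultrafilter.mem_map]
    refine Filter.univ_mem' fun n => ?_
    intro _
    have := hempK n
    simp only [nonpos_iff_eq_zero]
    rw [ProbabilityMeasure.null_iff_toMeasure_null]
    exact this)
  obtain ⟨μ, hμK, hlim⟩ := hU
  have hlim : Tendsto ν (hyperfilter ℕ : Filter ℕ) (𝓝 μ) := hlim
  have hμK : (μ : Measure (ℝ × ℝ)) Kᶜ = 0 := by
    have := hμK 0
    rw [nonpos_iff_eq_zero, ProbabilityMeasure.null_iff_toMeasure_null] at this
    exact this
  have hopen := fun (G : Set (ℝ × ℝ)) (hG : IsOpen G) =>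
    ProbabilityMeasure.le_liminf_measure_open_of_tendsto hlim hG
  have hclosed := fun (G : Set (ℝ × ℝ)) (hG : IsClosed G) =>
    ProbabilityMeasure.limsup_measure_closed_le_of_tendsto hlim hG
  have hinv0 : Tendsto (fun n : ℕ => ((n + 1 : ℕ) : ENNReal)⁻¹) (hyperfilter ℕ : Filter ℕ) (𝓝 0) := by
    have h1 := (tendsto_add_atTop_iff_nat 1).2 ENNReal.tendsto_inv_nat_nhds_zero
    exact h1.mono_left Nat.hyperfilter_le_atTop
  -- no atoms
  have hatom : ∀ p : ℝ × ℝ, (μ : Measure (ℝ × ℝ)) {p} = 0 := by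
    intro p
    have hb : ∀ N : ℕ, 0 < N → (μ : Measure (ℝ × ℝ)) {p} ≤ (N : ENNReal)⁻¹ := by
      intro N hN
      have : ∃ ε > 0, ∀ k, 0 < k → k < N → ∀ i, ε ≤ dist (x i) (x (i + k)) := by
        clear hN
        induction N with
        | zero => exact ⟨1, one_pos, by simp⟩
        | succ N ih =>
          obtain ⟨ε, hε, h⟩ := ih
          rcases Nat.eq_zero_or_pos N with h0 | h0
          · exact ⟨1, one_pos, by intros; omega⟩
          obtain ⟨ε', hε', h'⟩ := hret N h0
          refine ⟨min ε ε', lt_min hε hε', fun k hk hkN i => ?_⟩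
          rcases Nat.lt_succ_iff_lt_or_eq.1 hkN with hlt | rfl
          · exact (min_le_left _ _).trans (h k hk hlt i)
          · exact (min_le_right _ _).trans (h' i)
      obtain ⟨ε, hε, hsep⟩ := this
      have hball := hopen (Metric.ball p (ε / 2)) Metric.isOpen_ball
      have hle : ∀ n, emp x n (Metric.ball p (ε / 2)) ≤ (N : ENNReal)⁻¹ + ((n + 1 : ℕ) : ENNReal)⁻¹ := by
        intro n
        rw [emp_apply _ _ Metric.isOpen_ball.measurableSet]
        classical
        have hsum : ∑ i ∈ Finset.range (n + 1),
            (Metric.ball p (ε / 2)).indicator (1 : ℝ × ℝ → ENNReal) (x i)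
            = (((Finset.range (n + 1)).filter (fun i => x i ∈ Metric.ball p (ε / 2))).card : ENNReal) := by
          simp [Set.indicator_apply]
        rw [hsum]
        have hc := card_sep ((Finset.range (n + 1)).filter (fun i => x i ∈ Metric.ball p (ε / 2)))
          (n + 1) N hN (by intro i hi; simp at hi; omega) (by
            intro i hi j hj hij
            by_contra hlt
            push Not at hlt
            simp only [Finset.mem_filter, Metric.mem_ball] at hi hj
            have h1 := hsep (j - i) (by omega) hlt i
            rw [show i + (j - i) = j by omega] at h1
            have h2 := dist_triangle_right (x i) (x j) p
            linarith [hi.2, hj.2])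
        have hc' : (((Finset.range (n + 1)).filter
            (fun i => x i ∈ Metric.ball p (ε / 2))).card : ENNReal) ≤
            ((n + 1 : ℕ) : ENNReal) * (N : ENNReal)⁻¹ + 1 := by
          refine (Nat.cast_le.2 hc).trans ?_
          rw [Nat.cast_add, Nat.cast_one]
          gcongr
          rw [← div_eq_mul_inv, ENNReal.le_div_iff_mul_le (by left; simp; omega) (by left; simp)]
          exact_mod_cast Nat.div_mul_le_self _ _
        calc _ ≤ ((n + 1 : ℕ) : ENNReal)⁻¹ * (((n + 1 : ℕ) : ENNReal) * (N : ENNReal)⁻¹ + 1) := by gcongr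
          _ = _ := by
            rw [mul_add, ← mul_assoc, ENNReal.inv_mul_cancel (by simp) (by simp), one_mul, mul_one]
      have ht : Tendsto (fun n : ℕ => (N : ENNReal)⁻¹ + ((n + 1 : ℕ) : ENNReal)⁻¹)
          (hyperfilter ℕ : Filter ℕ) (𝓝 ((N : ENNReal)⁻¹ + 0)) := tendsto_const_nhds.add hinv0
      have hl : liminf (fun n => (ν n : Measure (ℝ × ℝ)) (Metric.ball p (ε / 2)))
          (hyperfilter ℕ : Filter ℕ) ≤ (N : ENNReal)⁻¹ + 0 := by
        rw [← ht.liminf_eq]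
        exact liminf_le_liminf (Eventually.of_forall hle)
      calc (μ : Measure (ℝ × ℝ)) {p} ≤ (μ : Measure (ℝ × ℝ)) (Metric.ball p (ε / 2)) :=
            measure_mono (by simpa using by positivity)
        _ ≤ _ := hball
        _ ≤ _ := hl
        _ = _ := add_zero _
    have := ENNReal.tendsto_inv_nat_nhds_zero
    refine le_antisymm (ge_of_tendsto this ?_) (zero_le)
    filter_upwards [eventually_gt_atTop 0] with N hN using hb N hN
  have hD0 : (μ : Measure (ℝ × ℝ)) D = 0 :=
    haveI : NullSingletonClass (μ : Measure (ℝ × ℝ)) := ⟨hatom⟩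
    hD.measure_zero _
  -- invariance
  have hstep : ∀ U : Set (ℝ × ℝ), IsOpen U →
      (μ : Measure (ℝ × ℝ)) (f ⁻¹' U) ≤ (μ : Measure (ℝ × ℝ)) (closure U) := by
    intro U hUo
    have h1 : (μ : Measure (ℝ × ℝ)) (f ⁻¹' U) ≤ (μ : Measure (ℝ × ℝ)) (interior (f ⁻¹' U)) := by
      have hsub : f ⁻¹' U ⊆ interior (f ⁻¹' U) ∪ (Kᶜ ∪ D) := by
        intro p hp
        by_cases hpK : p ∈ K
        · by_cases hpD : p ∈ D
          · right; right; exact hpD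
          · left
            rw [mem_interior_iff_mem_nhds]
            exact (hcont p hpK hpD) (hUo.mem_nhds hp)
        · right; left; exact hpK
      refine (measure_mono hsub).trans ((measure_union_le _ _).trans ?_)
      rw [measure_union_null hμK hD0, add_zero]
    have h2 := hopen _ (isOpen_interior (s := f ⁻¹' U))
    have h3 := hclosed _ (isClosed_closure (s := U))
    have hle : ∀ n, emp x n (interior (f ⁻¹' U)) ≤ emp x n (closure U) + ((n + 1 : ℕ) : ENNReal)⁻¹ := by
      intro n
      refine (measure_mono (interior_subset)).trans ?_
      have hUc : emp x n U ≤ emp x n (closure U) := measure_mono subset_closure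
      refine le_trans ?_ (add_le_add_left hUc _)
      rw [emp_apply _ _ (hf hUo.measurableSet), emp_apply _ _ hUo.measurableSet]
      have : ∀ i, (f ⁻¹' U).indicator (1 : ℝ × ℝ → ENNReal) (x i)
          = U.indicator (1 : ℝ × ℝ → ENNReal) (x (i + 1)) := by
        intro i
        simp only [hx, Function.iterate_succ_apply']
        rfl
      simp only [this]
      calc _ ≤ ((n + 1 : ℕ) : ENNReal)⁻¹ * (∑ i ∈ Finset.range (n + 1),
              U.indicator (1 : ℝ × ℝ → ENNReal) (x i) + 1) := by
            gcongr
            rw [Finset.sum_range_succ, Finset.sum_range_succ']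
            rw [add_assoc]
            gcongr
            refine le_trans ?_ le_add_self
            exact Set.indicator_le_self' (by simp) _
        _ = _ := by rw [mul_add, mul_one]
    refine h1.trans (h2.trans ?_)
    refine ENNReal.le_of_forall_pos_le_add fun δ hδ _ => ?_
    have hev : ∀ᶠ n in (hyperfilter ℕ : Filter ℕ), ((n + 1 : ℕ) : ENNReal)⁻¹ ≤ δ :=
      hinv0.eventually_le_const (by exact_mod_cast hδ)
    calc _ ≤ liminf (fun n => emp x n (closure U) + δ) (hyperfilter ℕ : Filter ℕ) := by
          refine liminf_le_liminf ?_
          filter_upwards [hev] with n hn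
          exact (hle n).trans (by gcongr)
      _ ≤ limsup (fun n => emp x n (closure U) + δ) (hyperfilter ℕ : Filter ℕ) := liminf_le_limsup
      _ = limsup (fun n => emp x n (closure U)) (hyperfilter ℕ : Filter ℕ) + δ :=
          limsup_add_const _ _ _ (by isBoundedDefault) (by isBoundedDefault)
      _ ≤ _ := by
          gcongr
          exact h3
  have hfp : IsProbabilityMeasure (Measure.map f (μ : Measure (ℝ × ℝ))) :=
    Measure.isProbabilityMeasure_map hf.aemeasurable
  have heq : Measure.map f (μ : Measure (ℝ × ℝ)) = μ := by
    refine eq_of_closed_le _ _ fun F hF => ?_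
    have ht := tendsto_measure_cthickening_of_isClosed (μ := (μ : Measure (ℝ × ℝ))) (s := F)
      ⟨1, one_pos, measure_ne_top _ _⟩ hF
    have ht' := ht.mono_left (nhdsWithin_le_nhds (s := Ioi (0 : ℝ)))
    refine ge_of_tendsto ht' ?_
    filter_upwards [self_mem_nhdsWithin] with δ hδ
    calc _ ≤ Measure.map f (μ : Measure (ℝ × ℝ)) (Metric.thickening δ F) :=
          measure_mono (Metric.self_subset_thickening hδ F)
      _ = (μ : Measure (ℝ × ℝ)) (f ⁻¹' (Metric.thickening δ F)) :=
          Measure.map_apply hf Metric.isOpen_thickening.measurableSet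
      _ ≤ _ := hstep _ Metric.isOpen_thickening
      _ ≤ _ := measure_mono (Metric.closure_thickening_subset_cthickening _ _)
  refine ⟨μ, inferInstance, hμK, fun A hA => ?_, hatom⟩
  rw [← Measure.map_apply hf hA, heq]

theorem periodic_case (f : ℝ × ℝ → ℝ × ℝ) (hf : Measurable f) (K : Set (ℝ × ℝ))
    (hK : MeasurableSet K) (g : ℝ → ℝ × ℝ) (hg : Measurable g) (I : Set ℝ) (hI : MeasurableSet I)
    (hI0 : volume I ≠ 0) (hI1 : volume I ≠ ⊤)
    (horb : ∀ t ∈ I, ∀ n, f^[n] (g t) ∈ K)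
    (hfib : ∀ n q, {t ∈ I | f^[n] (g t) = q}.Countable)
    (hper : ∀ t ∈ I, ∃ n k, f^[n + (k + 1)] (g t) = f^[n] (g t)) :
    ∃ μ : Measure (ℝ × ℝ), IsProbabilityMeasure μ ∧ μ Kᶜ = 0 ∧
      (∀ A : Set (ℝ × ℝ), MeasurableSet A → μ (f ⁻¹' A) = μ A) ∧ (∀ p : ℝ × ℝ, μ {p} = 0) := by
  have hm : ∀ n, Measurable (fun t => f^[n] (g t)) := fun n => (hf.iterate n).comp hg
  obtain ⟨n, k, hnk⟩ : ∃ n k, volume (I ∩ {t | f^[n + (k + 1)] (g t) = f^[n] (g t)}) ≠ 0 := by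
    by_contra hcon
    push Not at hcon
    apply hI0
    have : I ⊆ ⋃ n, ⋃ k, (I ∩ {t | f^[n + (k + 1)] (g t) = f^[n] (g t)}) := by
      intro t ht
      obtain ⟨n, k, h⟩ := hper t ht
      simp only [mem_iUnion]
      exact ⟨n, k, ht, h⟩
    refine measure_mono_null this ?_
    simp [measure_iUnion_null_iff, hcon]
  set A := I ∩ {t | f^[n + (k + 1)] (g t) = f^[n] (g t)} with hA
  have hAm : MeasurableSet A := hI.inter (measurableSet_eq_fun (hm _) (hm _))
  have hA1 : volume A ≠ ⊤ := ne_top_of_le_ne_top hI1 (measure_mono inter_subset_left)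
  set ρ : ℕ → Measure (ℝ × ℝ) := fun i => (volume.restrict A).map (fun t => f^[n + i] (g t)) with hρ
  have hρa : ∀ i S, MeasurableSet S → ρ i S = volume ({t | f^[n + i] (g t) ∈ S} ∩ A) := by
    intro i S hS
    rw [hρ]
    simp only
    rw [Measure.map_apply (hm _) hS, Measure.restrict_apply (hm _ hS)]
    rfl
  set c : ENNReal := (k + 1 : ℕ) * volume A with hc
  have hc0 : c ≠ 0 := mul_ne_zero (by simp) hnk
  have hc1 : c ≠ ⊤ := ENNReal.mul_ne_top (by simp) hA1
  have happ : ∀ S, (c⁻¹ • ∑ i ∈ Finset.range (k + 1), ρ i) S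
      = c⁻¹ * ∑ i ∈ Finset.range (k + 1), ρ i S := by
    intro S; simp
  refine ⟨c⁻¹ • ∑ i ∈ Finset.range (k + 1), ρ i, ⟨?_⟩, ?_, ?_, ?_⟩
  · rw [happ]
    have : ∀ i ∈ Finset.range (k + 1), ρ i univ = volume A := by
      intro i _
      rw [hρa i _ MeasurableSet.univ]; simp
    rw [Finset.sum_congr rfl this]
    simp only [Finset.sum_const, Finset.card_range, nsmul_eq_mul]
    exact ENNReal.inv_mul_cancel hc0 hc1
  · rw [happ]
    have : ∀ i ∈ Finset.range (k + 1), ρ i Kᶜ = 0 := by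
      intro i _
      rw [hρa i _ hK.compl]
      have : {t | f^[n + i] (g t) ∈ Kᶜ} ∩ A = ∅ := by
        ext t
        simp only [mem_inter_iff, mem_ofPred_eq, mem_empty_iff_false, iff_false]
        rintro ⟨h1, h2⟩
        exact h1 (horb t h2.1 _)
      rw [this, measure_empty]
    rw [Finset.sum_eq_zero this, mul_zero]
  · intro S hS
    rw [happ, happ]
    congr 1
    have h1 : ∀ i, ρ i (f ⁻¹' S) = ρ (i + 1) S := by
      intro i
      rw [hρa _ _ (hf hS), hρa _ _ hS]
      congr 1
      ext t
      simp only [mem_inter_iff, mem_ofPred_eq, mem_preimage]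
      rw [← add_assoc, Function.iterate_succ_apply']
    have h2 : ρ (k + 1) S = ρ 0 S := by
      rw [hρa _ _ hS, hρa _ _ hS]
      congr 1
      ext t
      simp only [mem_inter_iff, mem_ofPred_eq, add_zero]
      constructor
      · rintro ⟨h3, h4⟩
        exact ⟨by rw [← h4.2]; exact h3, h4⟩
      · rintro ⟨h3, h4⟩
        exact ⟨by rw [h4.2]; exact h3, h4⟩
    simp only [h1]
    rw [Finset.sum_range_succ, Finset.sum_range_succ', h2]
  · intro p
    rw [happ]
    have : ∀ i ∈ Finset.range (k + 1), ρ i {p} = 0 := by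
      intro i _
      rw [hρa i _ (measurableSet_singleton p)]
      refine Countable.measure_zero ((hfib (n + i) p).mono ?_) _
      rintro t ⟨h1, h2⟩
      exact ⟨h2.1, h1⟩
    rw [Finset.sum_eq_zero this, mul_zero]

/-- `cc b d j = d (1 + b + ⋯ + b^(j-1))`. -/
noncomputable def cc (b d : ℝ) : ℕ → ℝ
  | 0 => 0
  | (j + 1) => b * cc b d j + d

lemma cc_nonneg (b d : ℝ) (hb : 1 < b) (hd : 0 < d) (j : ℕ) : 0 ≤ cc b d j := by
  induction j with
  | zero => simp [cc]
  | succ j ih => rw [cc]; positivity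

lemma cc_step (b d : ℝ) (hb : 1 < b) (hd : 0 < d) (j : ℕ) : cc b d j + d ≤ cc b d (j + 1) := by
  rw [cc]; nlinarith [cc_nonneg b d hb hd j]

lemma cc_ge (b d : ℝ) (hb : 1 < b) (hd : 0 < d) (j : ℕ) : j * d ≤ cc b d j := by
  induction j with
  | zero => simp [cc]
  | succ j ih =>
    have := cc_step b d hb hd j
    push_cast; linarith

lemma cc_mono (b d : ℝ) (hb : 1 < b) (hd : 0 < d) : Monotone (cc b d) :=
  monotone_nat_of_le_succ fun j => by linarith [cc_step b d hb hd j]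

lemma cc_succ_ge (b d : ℝ) (hb : 1 < b) (hd : 0 < d) (j : ℕ) : d ≤ cc b d (j + 1) := by
  linarith [cc_step b d hb hd j, cc_nonneg b d hb hd j]

/-- the trapping region -/
def trap (b d m M : ℝ) (N : ℕ) : Set (ℝ × ℝ) :=
  {p | (∃ j ∈ Finset.range N, p.2 = cc b d j * (p.2 - p.1)) ∧
    m ≤ |p.2 - p.1| ∧ |p.2 - p.1| ≤ M ∧ |p.2| ≤ 1}

lemma trap_compact (b d m M : ℝ) (N : ℕ) : IsCompact (trap b d m M N) := by
  have hcl : IsClosed (trap b d m M N) := by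
    have h1 : IsClosed (⋃ j ∈ Finset.range N, {p : ℝ × ℝ | p.2 = cc b d j * (p.2 - p.1)}) :=
      isClosed_biUnion_finset fun j _ => isClosed_eq (by fun_prop) (by fun_prop)
    have h2 : IsClosed {p : ℝ × ℝ | m ≤ |p.2 - p.1|} := isClosed_le (by fun_prop) (by fun_prop)
    have h3 : IsClosed {p : ℝ × ℝ | |p.2 - p.1| ≤ M} := isClosed_le (by fun_prop) (by fun_prop)
    have h4 : IsClosed {p : ℝ × ℝ | |p.2| ≤ 1} := isClosed_le (by fun_prop) (by fun_prop)
    convert ((h1.inter h2).inter h3).inter h4 using 1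
    ext p
    simp only [trap, mem_inter_iff, mem_iUnion, mem_ofPred_eq, exists_prop, and_assoc]
  refine ((isCompact_Icc (a := -(M + 1)) (b := M + 1)).prod
    (isCompact_Icc (a := (-1 : ℝ)) (b := 1))).of_isClosed_subset hcl ?_
  rintro p ⟨-, -, h3, h4⟩
  rw [abs_le] at h3 h4
  simp only [mem_prod, mem_Icc]
  exact ⟨⟨by linarith, by linarith⟩, h4.1, h4.2⟩

lemma riskMap_meas (lam a : ℝ) : Measurable (riskMap lam a) := by
  have hP : Measurable Psi :=
    Measurable.ite (measurableSet_le (by fun_prop) (by fun_prop)) measurable_id measurable_const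
  unfold riskMap
  refine Measurable.prodMk (by fun_prop) (hP.comp (by fun_prop))

lemma psi_cont (t : ℝ) (ht : |t| ≠ 1) : ContinuousAt Psi t := by
  rcases lt_or_gt_of_ne ht with h | h
  · have : Psi =ᶠ[nhds t] id := by
      filter_upwards [(isOpen_lt continuous_abs continuous_const).mem_nhds h] with x hx
      have hx : |x| < 1 := hx
      simp [Psi, hx.le]
    exact continuousAt_id.congr this.symm
  · have : Psi =ᶠ[nhds t] fun _ => 0 := by
      filter_upwards [(isOpen_lt continuous_const continuous_abs).mem_nhds h] with x hx
      have hx : 1 < |x| := hx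
      simp [Psi, not_le.2 hx]
    exact continuousAt_const.congr this.symm

lemma trap_step (lam a m M : ℝ) (N : ℕ) (hl1 : -1 < lam) (hl0 : lam < 0) (hb : 1 < lam + a)
    (hm : m = -lam / (1 - lam)) (hM : M = (lam + a) / (1 + lam))
    (hN : 1 < cc (lam + a) (1 - lam) N * m) (p : ℝ × ℝ)
    (hp : p ∈ trap (lam + a) (1 - lam) m M N) :
    riskMap lam a p ∈ trap (lam + a) (1 - lam) m M N ∧
    ((riskMap lam a p).2 - (riskMap lam a p).1 = 1 * (p.2 - p.1) ∨
      ∃ j ∈ Finset.range N, (riskMap lam a p).2 - (riskMap lam a p).1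
        = (1 - cc (lam + a) (1 - lam) (j + 1)) * (p.2 - p.1)) := by
  obtain ⟨⟨j, hj, hs⟩, h1, h2, h3⟩ := hp
  have hd : 0 < 1 - lam := by linarith
  have hN0 : 0 < N := by
    rcases Nat.eq_zero_or_pos N with h | h
    · subst h; simp [cc] at hN; linarith
    · exact h
  set b := lam + a with hbdef
  have hτ : p.2 + (lam * p.1 + a * p.2) - p.1 = cc b (1 - lam) (j + 1) * (p.2 - p.1) := by
    rw [cc, add_mul, mul_assoc, ← hs, hbdef]; ring
  have hcpos : 0 < cc b (1 - lam) (j + 1) := by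
    linarith [cc_succ_ge b (1 - lam) hb hd j]
  set C := cc b (1 - lam) (j + 1) with hC
  have hf : riskMap lam a p = (C * (p.2 - p.1) + p.1 - p.2, Psi (C * (p.2 - p.1))) := by
    unfold riskMap
    rw [hτ, ← hτ]
    ext <;> simp
  rw [hf]
  have habs : |C * (p.2 - p.1)| = C * |p.2 - p.1| := by rw [abs_mul, abs_of_pos hcpos]
  have hm0 : 0 < m := by rw [hm]; apply div_pos <;> linarith
  by_cases hle : |C * (p.2 - p.1)| ≤ 1
  · have hP : Psi (C * (p.2 - p.1)) = C * (p.2 - p.1) := if_pos hle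
    rw [hP]
    have hu : C * (p.2 - p.1) - (C * (p.2 - p.1) + p.1 - p.2) = p.2 - p.1 := by ring
    refine ⟨⟨⟨j + 1, ?_, ?_⟩, ?_, ?_, ?_⟩, ?_⟩
    · rw [Finset.mem_range]
      by_contra hcon
      push Not at hcon
      have := cc_mono b (1 - lam) hb hd hcon
      rw [habs] at hle
      nlinarith
    · simp only [hu]; rfl
    · simpa only [hu] using h1
    · simpa only [hu] using h2
    · exact hle
    · left; simp only [hu]; ring
  · have hP : Psi (C * (p.2 - p.1)) = 0 := if_neg hle
    rw [hP]
    push Not at hle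
    rw [habs] at hle
    have hC1 : 1 - lam ≤ C := cc_succ_ge b (1 - lam) hb hd j
    have hu : (0 : ℝ) - (C * (p.2 - p.1) + p.1 - p.2) = (1 - C) * (p.2 - p.1) := by ring
    have hua : |(1 - C) * (p.2 - p.1)| = (C - 1) * |p.2 - p.1| := by
      rw [abs_mul, abs_of_neg (by linarith)]; ring
    refine ⟨⟨⟨0, by simpa using hN0, by simp [cc]⟩, ?_, ?_, by simp⟩, ?_⟩
    · simp only [hu, hua]
      have hmd : m * (1 - lam) = -lam := by rw [hm]; field_simp
      -- m = 1 - 1/(1-lam)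
      have : 1 ≤ |p.2 - p.1| * C := by linarith
      by_cases hbig : 1 ≤ |p.2 - p.1| * (1 - lam)
      · nlinarith
      · push Not at hbig
        nlinarith
    · simp only [hu, hua]
      have hMd : M * (1 + lam) = b := by rw [hM]; field_simp [show 1 + lam ≠ 0 by linarith]
      have hsa : |p.2| = cc b (1 - lam) j * |p.2 - p.1| := by
        conv_lhs => rw [hs]
        rw [abs_mul, abs_of_nonneg (cc_nonneg b _ hb hd j)]
      have : C = b * cc b (1 - lam) j + (1 - lam) := by rw [hC, cc]
      have : (C - 1) * |p.2 - p.1| = b * |p.2| + (-lam) * |p.2 - p.1| := by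
        rw [this, hsa]; ring
      rw [this]
      nlinarith
    · right
      exact ⟨j, hj, hu⟩

lemma iter_mult (f : ℝ × ℝ → ℝ × ℝ) (K : Set (ℝ × ℝ)) (Sg : Finset ℝ) (h0 : (0 : ℝ) ∉ Sg)
    (hK : ∀ p ∈ K, f p ∈ K)
    (h : ∀ p ∈ K, ∃ σ ∈ Sg, (f p).2 - (f p).1 = σ * (p.2 - p.1)) (k : ℕ) :
    ∃ F : Finset ℝ, (0 : ℝ) ∉ F ∧ ∀ p ∈ K, f^[k] p ∈ K ∧
      ∃ σ ∈ F, (f^[k] p).2 - (f^[k] p).1 = σ * (p.2 - p.1) := by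
  classical
  induction k with
  | zero => exact ⟨{1}, by simp, fun p hp => ⟨hp, 1, by simp, by simp⟩⟩
  | succ k ih =>
    obtain ⟨F, hF0, hF⟩ := ih
    refine ⟨(Sg ×ˢ F).image (fun x => x.1 * x.2), ?_, fun p hp => ?_⟩
    · simp only [Finset.mem_image, Finset.mem_product, not_exists, not_and]
      rintro ⟨x, y⟩ ⟨hx, hy⟩ hxy
      rcases mul_eq_zero.1 hxy with h | h
      · simp only at h hx; exact h0 (h ▸ hx)
      · simp only at h hy; exact hF0 (h ▸ hy)
    · obtain ⟨hk, σ, hσ, hu⟩ := hF p hp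
      obtain ⟨σ', hσ', hu'⟩ := h _ hk
      rw [Function.iterate_succ_apply']
      refine ⟨hK _ hk, σ' * σ, ?_, ?_⟩
      · exact Finset.mem_image.2 ⟨(σ', σ), by simp [hσ, hσ'], rfl⟩
      · rw [hu', hu]; ring

lemma finset_gap (F : Finset ℝ) : ∃ δ > 0, ∀ x ∈ F, |x| < δ → x = 0 := by
  classical
  induction F using Finset.induction_on with
  | empty => exact ⟨1, one_pos, by simp⟩
  | insert y F _ ih =>
    obtain ⟨δ, hδ, h⟩ := ih
    by_cases hy : y = 0
    · refine ⟨δ, hδ, fun x hx hlt => ?_⟩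
      rcases Finset.mem_insert.1 hx with rfl | hx
      · exact hy
      · exact h x hx hlt
    · refine ⟨min δ |y|, lt_min hδ (abs_pos.2 hy), fun x hx hlt => ?_⟩
      rcases Finset.mem_insert.1 hx with rfl | hx
      · exact absurd (hlt.trans_le (min_le_right _ _)) (lt_irrefl _)
      · exact h x hx (hlt.trans_le (min_le_left _ _))

lemma near_return (b d m M : ℝ) (N : ℕ) (hm : 0 < m) (F : Finset ℝ) :
    ∃ ε > 0, ∀ p ∈ trap b d m M N, ∀ r ∈ trap b d m M N,
      (∃ σ ∈ F, r.2 - r.1 = σ * (p.2 - p.1)) → dist p r < ε → r = p := by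
  classical
  obtain ⟨δ1, hδ1, h1⟩ := finset_gap (F.image (fun σ => σ - 1))
  obtain ⟨δ2, hδ2, h2⟩ := finset_gap
    ((Finset.range N ×ˢ Finset.range N).image (fun x => cc b d x.1 - cc b d x.2))
  refine ⟨min (δ1 * m / 2) (δ2 * m), lt_min (by positivity) (by positivity), ?_⟩
  rintro p ⟨⟨i, hi, hpi⟩, hpm, -⟩ r ⟨⟨j, hj, hrj⟩, -⟩ ⟨σ, hσ, hu⟩ hd
  have hd1 := hd.trans_le (min_le_left _ _)
  have hd2 := hd.trans_le (min_le_right _ _)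
  rw [Prod.dist_eq, max_lt_iff, Real.dist_eq, Real.dist_eq] at hd1 hd2
  have hσ1 : σ - 1 = 0 := by
    apply h1 _ (Finset.mem_image_of_mem _ hσ)
    have e : |σ - 1| * |p.2 - p.1| < δ1 * m := by
      rw [← abs_mul, show (σ - 1) * (p.2 - p.1) = (p.1 - r.1) - (p.2 - r.2) by linarith]
      have := abs_sub (p.1 - r.1) (p.2 - r.2)
      linarith [hd1.1, hd1.2]
    by_contra hcon
    push Not at hcon
    nlinarith [abs_nonneg (σ - 1)]
  have hσ' : σ = 1 := by linarith
  rw [hσ', one_mul] at hu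
  have hc : cc b d j - cc b d i = 0 := by
    apply h2 _ (Finset.mem_image.2 ⟨(j, i), by simp at hi hj; simp [hi, hj], rfl⟩)
    have e : |cc b d j - cc b d i| * |p.2 - p.1| < δ2 * m := by
      rw [← abs_mul, show (cc b d j - cc b d i) * (p.2 - p.1) = -(p.2 - r.2) by
        rw [sub_mul, ← hpi, ← hu, ← hrj]; ring, abs_neg]
      exact hd2.2
    by_contra hcon
    push Not at hcon
    nlinarith [abs_nonneg (cc b d j - cc b d i)]
  have hs : r.2 = p.2 := by
    rw [hrj, hpi, hu, show cc b d j = cc b d i by linarith]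
  ext
  · linarith
  · exact hs

/-- **Theorem 3, part 2.** Let `λ ∈ (-1,0)` and `β = λ + α > 1`. Then
the risk management map admits a non-atomic invariant Borel probability measure on
`L = ℝ × [-1,1]` whose topological support is disjoint from the fixed-point segment
`EF = {(x,s) : x = αs/(1-λ), -1 ≤ s ≤ 1}` (every point of `EF` has an open
neighborhood of measure zero). -/
theorem riskMap_nonatomic_invariant_measure
    (lam a : ℝ) (hlam : lam ∈ Ioo (-1 : ℝ) 0) (hbeta : 1 < lam + a) :
    ∃ μ : Measure (ℝ × ℝ), IsProbabilityMeasure μ ∧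
      μ {p : ℝ × ℝ | p.2 ∈ Icc (-1 : ℝ) 1} = 1 ∧
      (∀ A : Set (ℝ × ℝ), MeasurableSet A → μ (riskMap lam a ⁻¹' A) = μ A) ∧
      (∀ p : ℝ × ℝ, μ {p} = 0) ∧
      (∀ p : ℝ × ℝ, p.1 = a * p.2 / (1 - lam) → p.2 ∈ Icc (-1 : ℝ) 1 →
        ∃ U : Set (ℝ × ℝ), IsOpen U ∧ p ∈ U ∧ μ U = 0) := by
  classical
  obtain ⟨hl1, hl0⟩ := hlam
  have hd : 0 < 1 - lam := by linarith
  obtain ⟨m, hm⟩ : ∃ m, m = -lam / (1 - lam) := ⟨_, rfl⟩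
  obtain ⟨M, hM⟩ : ∃ M, M = (lam + a) / (1 + lam) := ⟨_, rfl⟩
  have hm0 : 0 < m := by rw [hm]; apply div_pos <;> linarith
  have hm1 : m ≤ 1 := by rw [hm, div_le_one hd]; linarith
  have hM1 : 1 < M := by rw [hM, one_lt_div (by linarith)]; linarith
  obtain ⟨N, hN⟩ : ∃ N, 1 < cc (lam + a) (1 - lam) N * m := by
    obtain ⟨N, hN⟩ := exists_nat_gt (1 / m)
    refine ⟨N, ?_⟩
    have h1 := cc_ge (lam + a) (1 - lam) hbeta hd N
    rw [div_lt_iff₀ hm0] at hN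
    have h2 : (N : ℝ) ≤ cc (lam + a) (1 - lam) N := by
      have : (0 : ℝ) ≤ N := Nat.cast_nonneg N
      nlinarith
    nlinarith
  have hN0 : 0 < N := by
    rcases Nat.eq_zero_or_pos N with h | h
    · subst h; simp [cc] at hN; linarith
    · exact h
  set K := trap (lam + a) (1 - lam) m M N with hKdef
  have hK : IsCompact K := trap_compact _ _ _ _ _
  have hstep := trap_step lam a m M N hl1 hl0 hbeta hm hM hN
  set f := riskMap lam a with hfdef
  have hfm : Measurable f := riskMap_meas lam a
  let Sg : Finset ℝ := insert 1 ((Finset.range N).image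
    (fun j => 1 - cc (lam + a) (1 - lam) (j + 1)))
  have hSg0 : (0 : ℝ) ∉ Sg := by
    simp only [Sg, Finset.mem_insert, Finset.mem_image, not_or, not_exists, not_and]
    refine ⟨by norm_num, fun j _ h => ?_⟩
    linarith [cc_succ_ge (lam + a) (1 - lam) hbeta hd j]
  have hmult := iter_mult f K Sg hSg0 (fun p hp => (hstep p hp).1) (fun p hp => by
    rcases (hstep p hp).2 with h | ⟨j, hj, h⟩
    · exact ⟨1, Finset.mem_insert_self _ _, h⟩
    · exact ⟨_, Finset.mem_insert_of_mem (Finset.mem_image_of_mem _ hj), h⟩)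
  have hiter : ∀ k, ∀ p ∈ K, f^[k] p ∈ K := by
    intro k p hp
    obtain ⟨F, -, hF⟩ := hmult k
    exact (hF p hp).1
  let g : ℝ → ℝ × ℝ := fun t => (-t, 0)
  have hgK : ∀ t ∈ Icc 1 M, g t ∈ K := by
    rintro t ⟨ht1, ht2⟩
    have : |(0 : ℝ) - -t| = t := by
      rw [zero_sub, neg_neg, abs_of_nonneg (by linarith)]
    refine ⟨⟨0, by simpa using hN0, by simp [g, cc]⟩, ?_, ?_, by simp [g]⟩
    · simp only [g, this]; linarith
    · simp only [g, this]; exact ht2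
  -- the set of discontinuities in the trapping region is countable
  let D : Set (ℝ × ℝ) := {p ∈ K | |p.2 + (lam * p.1 + a * p.2) - p.1| = 1}
  have hD : D.Countable := by
    let e : ℝ → ℕ → ℝ × ℝ := fun z j =>
      (cc (lam + a) (1 - lam) j * (z / cc (lam + a) (1 - lam) (j + 1))
        - z / cc (lam + a) (1 - lam) (j + 1),
       cc (lam + a) (1 - lam) j * (z / cc (lam + a) (1 - lam) (j + 1)))
    refine ((countable_range (e 1)).union (countable_range (e (-1)))).mono ?_
    rintro p ⟨⟨⟨j, hj, hs⟩, -⟩, hτ⟩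
    have hτ' : p.2 + (lam * p.1 + a * p.2) - p.1
        = cc (lam + a) (1 - lam) (j + 1) * (p.2 - p.1) := by
      rw [cc, add_mul, mul_assoc, ← hs]; ring
    have hcpos : 0 < cc (lam + a) (1 - lam) (j + 1) := by
      linarith [cc_succ_ge (lam + a) (1 - lam) hbeta hd j]
    have key : ∀ z, cc (lam + a) (1 - lam) (j + 1) * (p.2 - p.1) = z → e z j = p := by
      intro z hz
      have hu : z / cc (lam + a) (1 - lam) (j + 1) = p.2 - p.1 := by
        rw [← hz]; field_simp
      simp only [e, hu, ← hs]
      ext <;> simp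
    rw [hτ'] at hτ
    rcases eq_or_eq_neg_of_abs_eq hτ with h | h
    · left; exact ⟨j, key _ h⟩
    · right; exact ⟨j, key _ h⟩
  have hcont : ∀ p ∈ K, p ∉ D → ContinuousAt f p := by
    intro p hp hpD
    have hne : |p.2 + (lam * p.1 + a * p.2) - p.1| ≠ 1 := fun h => hpD ⟨hp, h⟩
    have h2 : ContinuousAt (fun p : ℝ × ℝ => p.2 + (lam * p.1 + a * p.2) - p.1) p := by fun_prop
    have h1 : ContinuousAt (fun p : ℝ × ℝ => lam * p.1 + a * p.2) p := by fun_prop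
    exact h1.prodMk (ContinuousAt.comp (f := fun p : ℝ × ℝ => p.2 + (lam * p.1 + a * p.2) - p.1)
      (psi_cont _ hne) h2)
  have main : ∃ μ : Measure (ℝ × ℝ), IsProbabilityMeasure μ ∧ μ Kᶜ = 0 ∧
      (∀ A : Set (ℝ × ℝ), MeasurableSet A → μ (f ⁻¹' A) = μ A) ∧ (∀ p : ℝ × ℝ, μ {p} = 0) := by
    by_cases hper : ∀ t ∈ Icc 1 M, ∃ n k, f^[n + (k + 1)] (g t) = f^[n] (g t)
    · refine periodic_case f hfm K hK.measurableSet g (by fun_prop) (Icc 1 M) measurableSet_Icc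
        (by simp [hM1]) (by simp) (fun t ht n => hiter n _ (hgK t ht)) ?_ hper
      intro n q
      obtain ⟨F, hF0, hF⟩ := hmult n
      refine ((F.image (fun σ => (q.2 - q.1) / σ)).countable_toSet).mono ?_
      rintro t ⟨ht, htq⟩
      obtain ⟨-, σ, hσ, hu⟩ := hF _ (hgK t ht)
      rw [htq] at hu
      have hσ0 : σ ≠ 0 := fun h => hF0 (h ▸ hσ)
      simp only [Finset.coe_image, mem_image]
      refine ⟨σ, hσ, ?_⟩
      rw [hu]; simp only [g]; field_simp; ring
    · push Not at hper
      obtain ⟨t, ht, hnp⟩ := hper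
      refine kb f hfm K D hK hD hcont (g t) (fun n => hiter n _ (hgK t ht)) ?_
      intro k hk
      obtain ⟨F, -, hF⟩ := hmult k
      obtain ⟨ε, hε, hε'⟩ := near_return (lam + a) (1 - lam) m M N hm0 F
      refine ⟨ε, hε, fun i => ?_⟩
      by_contra hcon
      push Not at hcon
      obtain ⟨k, rfl⟩ : ∃ k', k = k' + 1 := ⟨k - 1, by omega⟩
      apply hnp i k
      have hi := hiter i _ (hgK t ht)
      have hFi := hF _ hi
      rw [← Function.iterate_add_apply, add_comm (k + 1) i] at hFi
      exact hε' _ hi _ hFi.1 hFi.2 hcon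
  obtain ⟨μ, hμ, hμK, hinv, hat⟩ := main
  refine ⟨μ, hμ, ?_, hinv, hat, ?_⟩
  · have hms : MeasurableSet {p : ℝ × ℝ | p.2 ∈ Icc (-1 : ℝ) 1} :=
      measurable_snd measurableSet_Icc
    rw [← prob_compl_eq_zero_iff hms]
    refine measure_mono_null (compl_subset_compl.2 ?_) hμK
    rintro p ⟨-, -, -, h4⟩
    exact abs_le.1 h4
  · intro p hp1 hp2
    refine ⟨Kᶜ, hK.isClosed.isOpen_compl, ?_, hμK⟩
    rintro ⟨⟨j, hj, hs⟩, h1, -, -⟩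
    have hx : p.1 * (1 - lam) = a * p.2 := by rw [hp1]; field_simp
    have hc := cc_nonneg (lam + a) (1 - lam) hbeta hd j
    set c := cc (lam + a) (1 - lam) j
    have e : (p.2 - p.1) * ((1 - lam) + (lam + a - 1) * c) = 0 := by
      have : (lam + a - 1) * p.2 = (lam + a - 1) * (c * (p.2 - p.1)) := by rw [← hs]
      linarith
    have hpos : 0 < (1 - lam) + (lam + a - 1) * c := by
      have : 0 ≤ (lam + a - 1) * c := mul_nonneg (by linarith) hc
      linarith
    rcases mul_eq_zero.1 e with h | h
    · rw [h, abs_zero] at h1; linarith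
    · linarith
end

section
/- Let λ ∈ (−1,0), α ∈ ℝ, β = λ + α > 1, and let f be the map on L = ℝ × [−1,1] given by f(x,s) = (λx + αs, Ψ(s + (λx + αs) − x)), where Ψ(τ) = τ if |τ| ≤ 1 and Ψ(τ) = 0 otherwise. Then the set of non-wandering points of f that do not belong to the fixed-point segment EF = {(x,s) : x = αs/(1−λ), −1 ≤ s ≤ 1} is uncountable. -/
open Set

/-- Existence of a minimal set for a continuous self-map of a compact set. -/
lemma exists_minimal_set {Z : Type*} [TopologicalSpace Z] [T2Space Z] (S : Z → Z)
    (Y : Set Z) (hY : IsCompact Y) (hne : Y.Nonempty) (hSY : MapsTo S Y Y) :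
    ∃ M ⊆ Y, IsClosed M ∧ M.Nonempty ∧ MapsTo S M M ∧
      ∀ C ⊆ M, IsClosed C → C.Nonempty → MapsTo S C C → C = M := by
  obtain ⟨M, hMY, hM⟩ := zorn_superset_nonempty
    {C : Set Z | C ⊆ Y ∧ IsClosed C ∧ C.Nonempty ∧ MapsTo S C C} (by
      intro c hc hchain hcne
      refine ⟨⋂₀ c, ⟨?_, ?_, ?_, ?_⟩, fun s hs => sInter_subset_of_mem hs⟩
      · obtain ⟨s, hs⟩ := hcne
        exact (sInter_subset_of_mem hs).trans (hc hs).1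
      · exact isClosed_sInter fun s hs => (hc hs).2.1
      · have := hcne.to_subtype
        refine IsCompact.nonempty_sInter_of_directed_nonempty_isCompact_isClosed ?_ ?_ ?_ ?_
        · intro s hs t ht
          rcases hchain.total hs ht with h | h
          · exact ⟨s, hs, Subset.rfl, h⟩
          · exact ⟨t, ht, h, Subset.rfl⟩
        · exact fun s hs => (hc hs).2.2.1
        · exact fun s hs => hY.of_isClosed_subset (hc hs).2.1 (hc hs).1
        · exact fun s hs => (hc hs).2.1
      · intro x hx s hs
        exact (hc hs).2.2.2 (hx s hs)) Y ⟨Subset.rfl, hY.isClosed, hne, hSY⟩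
  refine ⟨M, hMY, hM.prop.2.1, hM.prop.2.2.1, hM.prop.2.2.2, ?_⟩
  intro C hCM hCc hCne hCS
  exact Subset.antisymm hCM (hM.le_of_le ⟨hCM.trans hMY, hCc, hCne, hCS⟩ hCM)

/-- A piecewise linear (homogeneous) map of the line, finitely many pieces on the compact
invariant set `J`, has uncountably many non-wandering points. -/
lemma abstract_uncountable (m : ℕ → ℝ) (k : ℝ → ℕ) (J : Set ℝ) (hJ : IsCompact J)
    (hJne : J.Nonempty) (hJ0 : (0 : ℝ) ∉ J) (g : ℝ → ℝ) (hgdef : ∀ x, g x = m (k x) * x)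
    (hg : MapsTo g J J) (K : ℕ) (hk : ∀ x ∈ J, k x ≤ K)
    (hL : ∀ x ∈ J, ∃ δ < (1 : ℝ), ∀ t, δ < t → t ≤ 1 → k (t * x) = k x) :
    ¬ Set.Countable {x : ℝ | x ≠ 0 ∧ ∀ U : Set ℝ, IsOpen U → x ∈ U →
      ∃ n : ℕ, 1 ≤ n ∧ ∃ q ∈ U, g^[n] q ∈ U} := by
  intro hN
  set N := {x : ℝ | x ≠ 0 ∧ ∀ U : Set ℝ, IsOpen U → x ∈ U →
      ∃ n : ℕ, 1 ≤ n ∧ ∃ q ∈ U, g^[n] q ∈ U} with hNdef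
  let S : ℝ × (ℕ → ℕ) → ℝ × (ℕ → ℕ) := fun p => (m (p.2 0) * p.1, fun i => p.2 (i + 1))
  have hS : Continuous S := by
    have h1 : Continuous m := continuous_of_discreteTopology
    have h2 : Continuous fun p : ℝ × (ℕ → ℕ) => m (p.2 0) :=
      h1.comp ((continuous_apply 0).comp continuous_snd)
    refine (h2.mul continuous_fst).prodMk ?_
    exact continuous_pi fun i => (continuous_apply (i + 1)).comp continuous_snd
  have hSn : ∀ n, Continuous S^[n] := fun n => hS.iterate n
  let it : ℝ → ℕ → ℕ := fun x n => k (g^[n] x)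
  have hSit : ∀ x, S (x, it x) = (g x, it (g x)) := by
    intro x
    simp only [S, it, Function.iterate_succ_apply, Function.iterate_zero, id, hgdef x]
  have hSitn : ∀ n x, S^[n] (x, it x) = (g^[n] x, it (g^[n] x)) := by
    intro n
    induction n with
    | zero => intro x; rfl
    | succ n ih => intro x; rw [Function.iterate_succ_apply, hSit, ih]; rfl
  have hSfst : ∀ n (p : ℝ × (ℕ → ℕ)),
      (S^[n] p).1 = (∏ i ∈ Finset.range n, m (p.2 i)) * p.1 := by
    intro n
    induction n with
    | zero => intro p; simp
    | succ n ih =>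
      intro p
      rw [Function.iterate_succ_apply, ih, Finset.prod_range_succ']
      simp only [S]
      ring
  let Y0 : Set (ℝ × (ℕ → ℕ)) := (fun x => (x, it x)) '' J
  have hbox : IsCompact (J ×ˢ (Set.pi univ fun _ : ℕ => Iic K)) :=
    hJ.prod (isCompact_univ_pi fun _ => (finite_Iic K).isCompact)
  have hgn : ∀ n, MapsTo g^[n] J J := fun n => hg.iterate n
  have hY0 : Y0 ⊆ J ×ˢ (Set.pi univ fun _ : ℕ => Iic K) := by
    rintro _ ⟨x, hx, rfl⟩
    exact ⟨hx, fun n _ => hk _ (hgn n hx)⟩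
  have hYbox := closure_minimal hY0 hbox.isClosed
  have hYc : IsCompact (closure Y0) := hbox.of_isClosed_subset isClosed_closure hYbox
  have hSY : MapsTo S (closure Y0) (closure Y0) := by
    refine MapsTo.closure ?_ hS
    rintro _ ⟨x, hx, rfl⟩
    exact ⟨g x, hg hx, (hSit x).symm⟩
  obtain ⟨M, hMY, hMc, hMne, hMS, hmin⟩ :=
    exists_minimal_set S (closure Y0) hYc (hJne.image _).closure hSY
  -- recurrence
  have hrec : ∀ O : Set (ℝ × (ℕ → ℕ)), IsOpen O → ∀ p ∈ M, p ∈ O →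
      ∃ n : ℕ, 1 ≤ n ∧ S^[n] p ∈ O := by
    intro O hO p hpM hpO
    let C0 : Set (ℝ × (ℕ → ℕ)) := {z | ∃ n : ℕ, 1 ≤ n ∧ S^[n] p = z}
    have hC0 : C0 ⊆ M := by
      rintro _ ⟨n, -, rfl⟩
      exact hMS.iterate n hpM
    have hC : closure C0 = M := by
      refine hmin _ (closure_minimal hC0 hMc) isClosed_closure ?_ ?_
      · exact Set.Nonempty.closure ⟨S^[1] p, 1, le_rfl, rfl⟩
      · refine MapsTo.closure ?_ hS
        rintro _ ⟨n, hn, rfl⟩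
        exact ⟨n + 1, by omega, Function.iterate_succ_apply' _ _ _⟩
    have hp : p ∈ closure C0 := hC ▸ hpM
    obtain ⟨z, hzO, n, hn, rfl⟩ := mem_closure_iff.1 hp O hO hpO
    exact ⟨n, hn, hzO⟩
  have hne0 : ∀ p ∈ M, p.1 ≠ 0 := by
    intro p hp h0
    exact hJ0 (h0 ▸ (hYbox (hMY hp)).1)
  have hMN : ∀ p ∈ M, p.1 ∈ N := by
    intro p hp
    refine ⟨hne0 p hp, ?_⟩
    intro U hU hpU
    have hO : IsOpen (Prod.fst ⁻¹' U : Set (ℝ × (ℕ → ℕ))) := hU.preimage continuous_fst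
    obtain ⟨n, hn, hnU⟩ := hrec _ hO p hp hpU
    have hO2 := hO.inter (hO.preimage (hSn n))
    obtain ⟨z, hz, x, hx, rfl⟩ := mem_closure_iff.1 (hMY hp) _ hO2 ⟨hpU, hnU⟩
    refine ⟨n, hn, x, hz.1, ?_⟩
    have := hz.2
    simp only [mem_preimage, hSitn] at this
    exact this
  -- Baire
  have : CompactSpace M := isCompact_iff_compactSpace.1 (hYc.of_isClosed_subset hMc hMY)
  have : Nonempty M := hMne.to_subtype
  have := hN.to_subtype
  obtain ⟨⟨y, hy⟩, ⟨p, hpM⟩, hpint⟩ :=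
    nonempty_interior_of_iUnion_of_closed (X := M) (ι := N)
      (f := fun y => {p : M | p.1.1 = y.1})
      (fun y => isClosed_eq (continuous_fst.comp continuous_subtype_val) continuous_const)
      (by
        ext q
        simp only [mem_iUnion, mem_ofPred_eq, mem_univ, iff_true]
        exact ⟨⟨q.1.1, hMN _ q.2⟩, rfl⟩)
  obtain ⟨V, hVsub, hVo, hpV⟩ := mem_interior.1 hpint
  obtain ⟨O, hO, rfl⟩ := isOpen_induced_iff.1 hVo
  have hOy : ∀ q ∈ M, q ∈ O → q.1 = y := fun q hqM hqO => @hVsub ⟨q, hqM⟩ hqO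
  obtain ⟨n, hn, hnO⟩ := hrec O hO p hpM hpV
  have e1 : p.1 = y := hOy p hpM hpV
  have e2 : (S^[n] p).1 = y := hOy _ (hMS.iterate n hpM) hnO
  have hprod : ∏ i ∈ Finset.range n, m (p.2 i) = 1 := by
    rw [hSfst, e1] at e2
    have : y ≠ 0 := e1 ▸ hne0 p hpM
    exact mul_right_cancel₀ this (by rw [e2, one_mul])
  have hcyl : IsOpen {z : ℝ × (ℕ → ℕ) | ∀ i ∈ Finset.range n, z.2 i = p.2 i} := by
    have : {z : ℝ × (ℕ → ℕ) | ∀ i ∈ Finset.range n, z.2 i = p.2 i} =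
        ⋂ i ∈ Finset.range n, (fun z : ℝ × (ℕ → ℕ) => z.2 i) ⁻¹' {p.2 i} := by
      ext z; simp
    rw [this]
    refine isOpen_biInter_finset fun i _ => ?_
    exact (isOpen_discrete _).preimage ((continuous_apply i).comp continuous_snd)
  obtain ⟨z, hz, x, hx, rfl⟩ := mem_closure_iff.1 (hMY hpM) _ hcyl (fun i _ => rfl)
  have hper : g^[n] x = x := by
    have h1 := hSfst n (x, it x)
    rw [hSitn] at h1
    rw [show g^[n] x = _ from h1, Finset.prod_congr rfl fun i hi => by rw [hz i hi], hprod, one_mul]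
  -- homogeneity
  have hhom : ∀ n, ∃ δ < (1 : ℝ), ∀ t, δ < t → t ≤ 1 → g^[n] (t * x) = t * g^[n] x := by
    intro n
    induction n with
    | zero => exact ⟨0, one_pos, fun t _ _ => rfl⟩
    | succ n ih =>
      obtain ⟨δ, hδ, h⟩ := ih
      obtain ⟨δ', hδ', h'⟩ := hL _ (hgn n hx)
      refine ⟨max δ δ', max_lt hδ hδ', fun t ht ht1 => ?_⟩
      rw [Function.iterate_succ_apply', Function.iterate_succ_apply',
        h t (lt_of_le_of_lt (le_max_left _ _) ht) ht1, hgdef,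
        h' t (lt_of_le_of_lt (le_max_right _ _) ht) ht1, hgdef]
      ring
  obtain ⟨δ, hδ, h⟩ := hhom n
  have hx0 : x ≠ 0 := fun h0 => hJ0 (h0 ▸ hx)
  have hsub : (fun t => t * x) '' (Ioc (max δ 0) 1) ⊆ N := by
    rintro _ ⟨t, ht, rfl⟩
    have ht0 : 0 < t := lt_of_le_of_lt (le_max_right _ _) ht.1
    refine ⟨mul_ne_zero ht0.ne' hx0, fun U _ htU => ⟨n, hn, t * x, htU, ?_⟩⟩
    rw [h t (lt_of_le_of_lt (le_max_left _ _) ht.1) ht.2, hper]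
    exact htU
  have hc : (Ioc (max δ 0) 1).Countable :=
    countable_of_injective_of_countable_image (f := fun t => t * x)
      (mul_left_injective₀ hx0).injOn (hN.mono hsub)
  have hlt : max δ 0 < (1 : ℝ) := max_lt hδ one_pos
  have h1 := Cardinal.mk_Ioc_real hlt
  have h2 := hc.le_aleph0
  rw [h1] at h2
  exact absurd h2 (not_le.2 Cardinal.aleph0_lt_continuum)

/-- The thresholds `q_k = (1-λ)(1 + β + ... + β^{k-1})`. -/
noncomputable def qseq (lam a : ℝ) : ℕ → ℝ
  | 0 => 0
  | k + 1 => (lam + a) * qseq lam a k + (1 - lam)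

lemma qseq_ge (lam a : ℝ) (hl0 : lam < 0) (hb : 1 < lam + a) (k : ℕ) :
    (k : ℝ) ≤ qseq lam a k := by
  induction k with
  | zero => simp [qseq]
  | succ k ih =>
    have h0 : (0 : ℝ) ≤ k := Nat.cast_nonneg k
    push_cast
    simp only [qseq]
    nlinarith

/-- Escape time of the point `(x, 0)`. -/
noncomputable def esc (lam a : ℝ) (x : ℝ) : ℕ := sInf {k | 1 < qseq lam a k * |x|}

lemma esc_nonempty (lam a : ℝ) (hl0 : lam < 0) (hb : 1 < lam + a) (x : ℝ) (hx : x ≠ 0) :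
    {k | 1 < qseq lam a k * |x|}.Nonempty := by
  have hx' : 0 < |x| := abs_pos.2 hx
  obtain ⟨n, hn⟩ := exists_nat_gt (1 / |x|)
  refine ⟨n, ?_⟩
  rw [div_lt_iff₀ hx'] at hn
  have := qseq_ge lam a hl0 hb n
  rw [mem_ofPred_eq]
  nlinarith

lemma esc_spec (lam a : ℝ) (hl0 : lam < 0) (hb : 1 < lam + a) (x : ℝ) (hx : x ≠ 0) :
    1 < qseq lam a (esc lam a x) * |x| := Nat.sInf_mem (esc_nonempty lam a hl0 hb x hx)

lemma esc_min (lam a x : ℝ) (j : ℕ) (hj : j < esc lam a x) : qseq lam a j * |x| ≤ 1 :=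
  not_lt.1 (Nat.notMem_of_lt_sInf hj)

lemma esc_eq (lam a x : ℝ) (k : ℕ) (h1 : 1 < qseq lam a k * |x|)
    (h2 : ∀ j < k, qseq lam a j * |x| ≤ 1) : esc lam a x = k := by
  apply le_antisymm
  · exact Nat.sInf_le h1
  · by_contra! h
    have h3 : 1 < qseq lam a (esc lam a x) * |x| :=
      Nat.sInf_mem (s := {k | 1 < qseq lam a k * |x|}) ⟨k, h1⟩
    exact absurd h3 (not_lt.2 (h2 _ h))

lemma abs_q (lam a : ℝ) (hl0 : lam < 0) (hb : 1 < lam + a) (x : ℝ) (j : ℕ) :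
    |-(qseq lam a j * x)| = qseq lam a j * |x| := by
  rw [abs_neg, abs_mul, abs_of_nonneg ((Nat.cast_nonneg j).trans (qseq_ge lam a hl0 hb j))]

lemma risk_step (lam a : ℝ) (x : ℝ) (j : ℕ) :
    riskMap lam a (x - qseq lam a j * x, -(qseq lam a j * x)) =
      (x - qseq lam a (j + 1) * x, Psi (-(qseq lam a (j + 1) * x))) := by
  simp only [riskMap, qseq]
  refine Prod.ext ?_ ?_
  · simp only; ring
  · simp only; congr 1; ring

lemma risk_iter (lam a : ℝ) (hl0 : lam < 0) (hb : 1 < lam + a) (x : ℝ) (j : ℕ)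
    (hj : j < esc lam a x) :
    (riskMap lam a)^[j] (x, 0) = (x - qseq lam a j * x, -(qseq lam a j * x)) := by
  induction j with
  | zero => simp [qseq]
  | succ j ih =>
    rw [Function.iterate_succ_apply', ih (by omega), risk_step, Psi, if_pos]
    rw [abs_q lam a hl0 hb]
    exact esc_min lam a x _ hj

lemma esc_pos (lam a : ℝ) (hl0 : lam < 0) (hb : 1 < lam + a) (x : ℝ) (hx : x ≠ 0) :
    1 ≤ esc lam a x := by
  by_contra! h
  have h0 : esc lam a x = 0 := by omega
  have := esc_spec lam a hl0 hb x hx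
  rw [h0] at this
  simp only [qseq] at this
  linarith

/-- The return map to the line `s = 0`. -/
noncomputable def gret (lam a : ℝ) (x : ℝ) : ℝ := (1 - qseq lam a (esc lam a x)) * x

lemma risk_return (lam a : ℝ) (hl0 : lam < 0) (hb : 1 < lam + a) (x : ℝ) :
    ∃ N : ℕ, 1 ≤ N ∧ (riskMap lam a)^[N] (x, 0) = (gret lam a x, 0) := by
  by_cases hx : x = 0
  · subst hx
    exact ⟨1, le_rfl, by simp [riskMap, gret, Psi]⟩
  · have hp := esc_pos lam a hl0 hb x hx
    obtain ⟨j, hj⟩ : ∃ j, esc lam a x = j + 1 := ⟨esc lam a x - 1, by omega⟩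
    refine ⟨esc lam a x, hp, ?_⟩
    have hs := esc_spec lam a hl0 hb x hx
    rw [gret, hj, Function.iterate_succ_apply', risk_iter lam a hl0 hb x j (by omega), risk_step,
      Psi, if_neg]
    · refine Prod.ext ?_ rfl
      simp only; ring
    · rw [abs_q lam a hl0 hb, ← hj]
      exact not_le.2 hs

lemma risk_return_iter (lam a : ℝ) (hl0 : lam < 0) (hb : 1 < lam + a) (n : ℕ) (x : ℝ) :
    ∃ N : ℕ, n ≤ N ∧ (riskMap lam a)^[N] (x, 0) = ((gret lam a)^[n] x, 0) := by
  induction n with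
  | zero => exact ⟨0, le_rfl, rfl⟩
  | succ n ih =>
    obtain ⟨N, hN, h⟩ := ih
    obtain ⟨N', hN', h'⟩ := risk_return lam a hl0 hb ((gret lam a)^[n] x)
    refine ⟨N' + N, by omega, ?_⟩
    rw [Function.iterate_add_apply, h, h', Function.iterate_succ_apply']

lemma gret_mapsTo (lam a : ℝ) (hl0 : lam < 0) (hl1 : -1 < lam) (hb : 1 < lam + a) :
    MapsTo (gret lam a) {x | -lam / (1 - lam) ≤ |x| ∧ |x| ≤ lam + a + 1}
      {x | -lam / (1 - lam) ≤ |x| ∧ |x| ≤ lam + a + 1} := by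
  rintro x ⟨h1, h2⟩
  have hpos : 0 < 1 - lam := by linarith
  have hρ : 0 < -lam / (1 - lam) := div_pos (by linarith) hpos
  have hx' : 0 < |x| := hρ.trans_le h1
  have hx : x ≠ 0 := abs_pos.1 hx'
  obtain ⟨j, hj⟩ : ∃ j, esc lam a x = j + 1 :=
    ⟨esc lam a x - 1, by have := esc_pos lam a hl0 hb x hx; omega⟩
  have hs := esc_spec lam a hl0 hb x hx
  have hm := esc_min lam a x j (by omega)
  show _ ∧ _
  rw [gret, hj, abs_mul, div_le_iff₀ hpos]
  rw [hj] at hs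
  rcases Nat.eq_zero_or_pos j with h0 | h0
  · subst h0
    have e : qseq lam a (0 + 1) = 1 - lam := by simp [qseq]
    rw [e] at hs ⊢
    have e2 : |1 - (1 - lam)| = -lam := by
      rw [show 1 - (1 - lam) = lam by ring, abs_of_neg hl0]
    rw [e2]
    constructor
    · nlinarith
    · nlinarith
  · have hm1 := esc_min lam a x 1 (by omega)
    have e : qseq lam a 1 = 1 - lam := by simp [qseq]
    rw [e] at hm1
    have hq : (1 : ℝ) ≤ qseq lam a (j + 1) := by
      refine le_trans ?_ (qseq_ge lam a hl0 hb (j + 1))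
      push_cast
      have : (0 : ℝ) ≤ j := Nat.cast_nonneg j
      linarith
    have e2 : |1 - qseq lam a (j + 1)| = qseq lam a (j + 1) - 1 := by
      rw [abs_sub_comm, abs_of_nonneg (by linarith)]
    rw [e2]
    constructor
    · nlinarith
    · simp only [qseq]
      have hx1 : |x| ≤ 1 := by nlinarith
      nlinarith

/-- **Theorem 3, part 3.** Let `λ ∈ (-1,0)` and `β = λ + α > 1`. Then
the set of non-wandering points of the risk management map in `L = ℝ × [-1,1]` that do
not belong to the fixed-point segment `EF = {(x,s) : x = αs/(1-λ), -1 ≤ s ≤ 1}` is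
uncountable. A point `p ∈ L` is non-wandering if for every open neighborhood `U` of
`p` there are `n ≥ 1` and `q ∈ U ∩ L` with `f^[n] q ∈ U`. -/
theorem riskMap_nonwandering_off_EF_uncountable
    (lam a : ℝ) (hlam : lam ∈ Ioo (-1 : ℝ) 0) (hbeta : 1 < lam + a) :
    ¬ Set.Countable {p : ℝ × ℝ |
      p.2 ∈ Icc (-1 : ℝ) 1 ∧
      p.1 ≠ a * p.2 / (1 - lam) ∧
      ∀ U : Set (ℝ × ℝ), IsOpen U → p ∈ U →
        ∃ n : ℕ, 1 ≤ n ∧ ∃ q ∈ U, q.2 ∈ Icc (-1 : ℝ) 1 ∧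
          (riskMap lam a)^[n] q ∈ U} := by
  obtain ⟨hl1, hl0⟩ := hlam
  have hpos : 0 < 1 - lam := by linarith
  have hρ : 0 < -lam / (1 - lam) := div_pos (by linarith) hpos
  have hρ1 : -lam / (1 - lam) ≤ 1 := by rw [div_le_iff₀ hpos]; linarith
  obtain ⟨K, hK⟩ := exists_nat_gt (1 / (-lam / (1 - lam)))
  rw [div_lt_iff₀ hρ] at hK
  have key := abstract_uncountable (fun k => 1 - qseq lam a k) (esc lam a)
    {x | -lam / (1 - lam) ≤ |x| ∧ |x| ≤ lam + a + 1} (by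
      refine Metric.isCompact_of_isClosed_isBounded ?_ ?_
      · exact (isClosed_le continuous_const continuous_abs).inter
          (isClosed_le continuous_abs continuous_const)
      · refine (Metric.isBounded_closedBall (x := (0 : ℝ)) (r := lam + a + 1)).subset ?_
        intro x hx
        simpa using hx.2)
    ⟨1, by
      show _ ∧ _
      rw [abs_one]
      exact ⟨hρ1, by linarith⟩⟩
    (by
      intro h
      have := h.1
      rw [abs_zero] at this
      linarith)
    (gret lam a) (fun x => rfl) (gret_mapsTo lam a hl0 hl1 hbeta) K (by
      intro x hx
      refine Nat.sInf_le ?_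
      have h1 := hx.1
      have h2 := qseq_ge lam a hl0 hbeta K
      have h3 : (0 : ℝ) ≤ K := Nat.cast_nonneg K
      rw [mem_ofPred_eq]
      calc (1 : ℝ) < K * (-lam / (1 - lam)) := hK
        _ ≤ qseq lam a K * |x| := by gcongr; exact h3.trans h2)
    (by
      intro x hx
      have hx' : 0 < |x| := hρ.trans_le hx.1
      have hs := esc_spec lam a hl0 hbeta x (abs_pos.1 hx')
      have hs0 : 0 < qseq lam a (esc lam a x) * |x| := by linarith
      refine ⟨1 / (qseq lam a (esc lam a x) * |x|), by rw [div_lt_one hs0]; exact hs, ?_⟩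
      intro t ht ht1
      have ht0 : 0 < t := lt_trans (by positivity) ht
      rw [div_lt_iff₀ hs0] at ht
      refine esc_eq lam a _ _ ?_ ?_
      · rw [abs_mul, abs_of_pos ht0]
        linarith
      · intro j hj
        have h1 := esc_min lam a x j hj
        rw [abs_mul, abs_of_pos ht0]
        have h2 : 0 ≤ qseq lam a j * |x| :=
          mul_nonneg ((Nat.cast_nonneg j).trans (qseq_ge lam a hl0 hbeta j)) hx'.le
        nlinarith)
  intro hc
  apply key
  refine MapsTo.countable_of_injOn (f := fun x : ℝ => ((x, 0) : ℝ × ℝ)) ?_ ?_ hc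
  · rintro x ⟨hx0, hx⟩
    refine ⟨by simp, by simpa using hx0, ?_⟩
    intro U hU hxU
    have hcont : Continuous fun x : ℝ => ((x, 0) : ℝ × ℝ) := by fun_prop
    obtain ⟨n, hn, q, hqU, hgq⟩ := hx _ (hU.preimage hcont) hxU
    obtain ⟨N, hN, h⟩ := risk_return_iter lam a hl0 hbeta n q
    refine ⟨N, hn.trans hN, (q, 0), hqU, by simp, ?_⟩
    rw [h]
    exact hgq
  · intro x _ y _ h
    exact (Prod.mk.inj h).1
end
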